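/- Assume (F,∼) is a potential causality graph, λ satisfies condition (A), and (λ,μ,θ) satisfy the cluster-expansion condition. Let Λ be a deterministic strategy such that every walk in Bad(t) is π-stable (as holds for the π-stable strategy, which in each round repeatedly addresses the ≼_π-least flaw of F_σ − Γ⁺(I)). Then for every integer t ≥ 0, ∑_{τ∈Bad(t)} p(τ) ≤ γ^init · (∑_{R ∈ Ind^init} μ(R)) · θ^t, where Ind^init = ∪_{σ ∈ Ω : ω^init(σ)>0} Ind(F_σ) and μ(R) = ∏_{f∈R} μ_f. -/

import Mathlib

open scoped Classical

noncomputable section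

namespace LLLFormal

/-- A walk: an initial state together with a list of (flaw, next-state) steps. -/
structure Walk (Ω F : Type*) where
  start : Ω
  steps : List (F × Ω)

variable {Ω F : Type*}

/-- Validity of a list of steps from a given state, w.r.t. a step relation. -/
def ValidFrom (step : F → Ω → Ω → Prop) : Ω → List (F × Ω) → Prop
  | _, [] => True
  | σ, (f, σ') :: rest => step f σ σ' ∧ ValidFrom step σ' rest

/-- The state reached after performing the steps `l` starting from `σ`. -/
def endOf (σ : Ω) (l : List (F × Ω)) : Ω := (l.map Prod.snd).getLastD σ

/-- `τ` is a (valid) walk w.r.t. the step relation `step`. -/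
def Walk.Valid (step : F → Ω → Ω → Prop) (τ : Walk Ω F) : Prop := ValidFrom step τ.start τ.steps

/-- The flaw word of a walk. -/
def Walk.word (τ : Walk Ω F) : List F := τ.steps.map Prod.fst

/-- The final state of a walk. -/
def Walk.final (τ : Walk Ω F) : Ω := endOf τ.start τ.steps

/-- The length of a walk. -/
def Walk.len (τ : Walk Ω F) : ℕ := τ.steps.length

/-- Product of the transition probabilities along a list of steps. -/
def prodRho (ρ : F → Ω → Ω → ℝ) : Ω → List (F × Ω) → ℝ
  | _, [] => 1
  | σ, (f, σ') :: rest => ρ f σ σ' * prodRho ρ σ' rest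

/-- The weight `p(τ)` of a walk. -/
def Walk.wt (ωinit : Ω → ℝ) (ρ : F → Ω → Ω → ℝ) (τ : Walk Ω F) : ℝ :=
  ωinit τ.start * prodRho ρ τ.start τ.steps

/-- `λ_W = ∏_i λ_{w_i}`. -/
def wordWt (lam : F → ℝ) (W : List F) : ℝ := (W.map lam).prod

/-- The data of the objects, flaws, actions and resampling oracles:
`mem f σ` means `σ ∈ f`; `Act f σ` is the action set `A(f,σ)`;
`ρ f σ σ'` is the probability `ρ(σ'|f,σ)`, whose support is exactly `A(f,σ)`. -/
structure Setup (Ω F : Type*) [Fintype Ω] where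
  mem : F → Ω → Prop
  flaw_nonempty : ∀ f, ∃ σ, mem f σ
  Act : F → Ω → Set Ω
  act_nonempty : ∀ f σ, mem f σ → (Act f σ).Nonempty
  ρ : F → Ω → Ω → ℝ
  ρ_nonneg : ∀ f σ σ', 0 ≤ ρ f σ σ'
  ρ_support : ∀ f σ, mem f σ → ∀ σ', (0 < ρ f σ σ' ↔ σ' ∈ Act f σ)
  ρ_total : ∀ f σ, mem f σ → ∑ σ' : Ω, ρ f σ σ' = 1

variable [Fintype Ω]

/-- A valid step `σ →^f σ'`. -/
def Setup.step (S : Setup Ω F) (f : F) (σ σ' : Ω) : Prop := S.mem f σ ∧ σ' ∈ S.Act f σ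

/-- A probability distribution on `Ω`. -/
def IsProb (ω : Ω → ℝ) : Prop := (∀ σ, 0 ≤ ω σ) ∧ ∑ σ : Ω, ω σ = 1

/-- A probability distribution on `Ω` with full support. -/
def IsPosProb (ω : Ω → ℝ) : Prop := (∀ σ, 0 < ω σ) ∧ ∑ σ : Ω, ω σ = 1

/-- `γ^init = max_{σ∈Ω} ωinit σ / ω σ`. -/
def gammaInit [Nonempty Ω] (ωinit ω : Ω → ℝ) : ℝ :=
  Finset.univ.sup' Finset.univ_nonempty fun σ => ωinit σ / ω σ

/-- Condition (A): `λ_f ≥ ∑_{σ ∈ f : σ' ∈ A(f,σ)} ρ(σ'|f,σ) ω(σ)/ω(σ')`. -/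
def CondA (S : Setup Ω F) (ω : Ω → ℝ) (lam : F → ℝ) : Prop :=
  ∀ (f : F) (σ' : Ω),
    lam f ≥ ∑ σ : Ω, if S.mem f σ ∧ σ' ∈ S.Act f σ then S.ρ f σ σ' * ω σ / ω σ' else 0

/-- `(F, ∼)` is a potential causality graph:
for every valid step `σ →^f σ'`, `F_{σ'} ⊆ (F_σ − {f}) ∪ Γ(f)`. -/
def Causality (S : Setup Ω F) (sim : F → F → Prop) : Prop :=
  ∀ f σ σ', S.step f σ σ' → ∀ g, S.mem g σ' → (S.mem g σ ∧ g ≠ f) ∨ sim f g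

/-- A finite set of flaws is independent. -/
def IndepF (sim : F → F → Prop) (I : Finset F) : Prop :=
  ∀ f ∈ I, ∀ g ∈ I, f ≠ g → ¬ sim f g

/-- `B` is a partition of the word `W` into consecutive nonempty blocks of distinct,
pairwise non-neighbouring flaws, with each block contained in `Γ⁺` of the previous one. -/
def StablePartition (sim : F → F → Prop) (B : List (List F)) (W : List F) : Prop :=
  W = B.flatten ∧
  (∀ b ∈ B, b ≠ [] ∧ b.Nodup ∧ b.Pairwise fun f g => ¬ sim f g) ∧
  B.Chain' fun b₁ b₂ => ∀ g ∈ b₂, ∃ f ∈ b₁, f = g ∨ sim f g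

/-- A stable word. -/
def StableWord (sim : F → F → Prop) (W : List F) : Prop := ∃ B, StablePartition sim B W

/-- A stable partition whose blocks are listed in strictly increasing order. -/
def PiStablePartition [LinearOrder F] (sim : F → F → Prop) (B : List (List F))
    (W : List F) : Prop :=
  StablePartition sim B W ∧ ∀ b ∈ B, b.Chain' (· < ·)

/-- A π-stable word. -/
def PiStableWord [LinearOrder F] (sim : F → F → Prop) (W : List F) : Prop :=
  ∃ B, PiStablePartition sim B W

/-- A deterministic strategy: it assigns to every walk whose final state is flawed
a flaw present in the final state. -/
def IsStrategy (S : Setup Ω F) (Λ : Walk Ω F → F) : Prop :=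
  ∀ τ : Walk Ω F, Walk.Valid S.step τ → (∃ f, S.mem f (Walk.final τ)) →
    S.mem (Λ τ) (Walk.final τ)

/-- A walk follows the strategy `Λ`. -/
def Follows (Λ : Walk Ω F → F) (τ : Walk Ω F) : Prop :=
  ∀ (i : ℕ) (h : i < τ.steps.length),
    (τ.steps.get ⟨i, h⟩).1 = Λ ⟨τ.start, τ.steps.take i⟩

/-- The set `Bad(t)` of bad `t`-trajectories. -/
def Bad (S : Setup Ω F) (Λ : Walk Ω F → F) (ωinit : Ω → ℝ) (t : ℕ) : Set (Walk Ω F) :=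
  {τ | Walk.Valid S.step τ ∧ Walk.len τ = t ∧ Follows Λ τ ∧ 0 < ωinit τ.start}

/-- The cluster-expansion condition:
`(λ_f/μ_f) ∑_{S ∈ Ind(Γ(f))} μ(S) ≤ θ` for every flaw `f`. -/
def ClusterCond [Fintype F] (sim : F → F → Prop) (lam μ : F → ℝ) (θ : ℝ) : Prop :=
  ∀ f : F,
    lam f / μ f *
      ∑ I ∈ Finset.univ.filter (fun I : Finset F => (∀ g ∈ I, sim f g) ∧ IndepF sim I),
        ∏ g ∈ I, μ g ≤ θ

/-- `τ` is a prefix of `τ'`. -/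
def Walk.IsPrefix (τ τ' : Walk Ω F) : Prop := τ.start = τ'.start ∧ τ.steps <+: τ'.steps

/-- A valid set of walks: all walks follow one common deterministic strategy,
and no walk is a proper prefix of another one. -/
def ValidSet (S : Setup Ω F) (X : Set (Walk Ω F)) : Prop :=
  (∀ τ ∈ X, Walk.Valid S.step τ) ∧
  (∃ Λ : Walk Ω F → F, IsStrategy S Λ ∧ ∀ τ ∈ X, Follows Λ τ) ∧
  ∀ τ ∈ X, ∀ τ' ∈ X, Walk.IsPrefix τ τ' → τ = τ'

/-- Atomicity of the resampling oracles. -/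
def Atomic (S : Setup Ω F) : Prop :=
  ∀ f σ' σ₁ σ₂, S.step f σ₁ σ' → S.step f σ₂ σ' → σ₁ = σ₂

/-- The map `swap` sends every swappable pair of steps to a valid pair of steps. -/
def SwapValid (S : Setup Ω F) (sim : F → F → Prop) (swap : Ω → F → Ω → F → Ω → Ω) : Prop :=
  ∀ σ₁ f σ₂ g σ₃, S.step f σ₁ σ₂ → S.step g σ₂ σ₃ → ¬ sim f g →
    S.step g σ₁ (swap σ₁ f σ₂ g σ₃) ∧ S.step f (swap σ₁ f σ₂ g σ₃) σ₃

/-- The map `swap` is injective (as a map of two-step walks). -/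
def SwapInj (S : Setup Ω F) (sim : F → F → Prop) (swap : Ω → F → Ω → F → Ω → Ω) : Prop :=
  ∀ σ₁ f σ₂ τ₂ g σ₃, S.step f σ₁ σ₂ → S.step g σ₂ σ₃ → S.step f σ₁ τ₂ → S.step g τ₂ σ₃ →
    ¬ sim f g → swap σ₁ f σ₂ g σ₃ = swap σ₁ f τ₂ g σ₃ → σ₂ = τ₂

/-- The map `swap` preserves the product of the two transition probabilities. -/
def SwapProb (S : Setup Ω F) (sim : F → F → Prop) (swap : Ω → F → Ω → F → Ω → Ω) : Prop :=
  ∀ σ₁ f σ₂ g σ₃, S.step f σ₁ σ₂ → S.step g σ₂ σ₃ → ¬ sim f g →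
    S.ρ f σ₁ σ₂ * S.ρ g σ₂ σ₃ =
      S.ρ g σ₁ (swap σ₁ f σ₂ g σ₃) * S.ρ f (swap σ₁ f σ₂ g σ₃) σ₃

/-- `(ρ, ∼)` is weakly commutative. -/
def WeakComm (S : Setup Ω F) (sim : F → F → Prop) : Prop :=
  ∃ swap, SwapValid S sim swap ∧ SwapInj S sim swap

/-- `(ρ, ∼)` is strongly commutative. -/
def StrongComm (S : Setup Ω F) (sim : F → F → Prop) : Prop :=
  ∃ swap, SwapValid S sim swap ∧ SwapInj S sim swap ∧ SwapProb S sim swap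

/-- One valid swap transforming the walk `τ` into the walk `τ'`. -/
def SwapStep (S : Setup Ω F) (sim : F → F → Prop) (swap : Ω → F → Ω → F → Ω → Ω)
    (τ τ' : Walk Ω F) : Prop :=
  ∃ (A B : List (F × Ω)) (f g : F) (σ₂ σ₃ : Ω),
    f ≠ g ∧ ¬ sim f g ∧
    S.step f (endOf τ.start A) σ₂ ∧ S.step g σ₂ σ₃ ∧
    τ.steps = A ++ (f, σ₂) :: (g, σ₃) :: B ∧
    τ' = ⟨τ.start, A ++ (g, swap (endOf τ.start A) f σ₂ g σ₃) :: (f, σ₃) :: B⟩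

/-- `U` is a chain of the walk `τ`. -/
def IsChainOf (sim : F → F → Prop) (U : List F) (τ : Walk Ω F) : Prop :=
  U.Sublist (Walk.word τ) ∧ U.Chain' fun a b => a = b ∨ sim a b

/-- The longest prefix of `W` ending with `f` (empty if `f` does not occur in `W`). -/
def prefEnd (f : F) (W : List F) : List F :=
  (W.reverse.dropWhile fun x => decide (x ≠ f)).reverse

/-- `W^f_τ` for `f ∈ F ∪ {∅}`. -/
def prefOpt (fo : Option F) (W : List F) : List F :=
  match fo with
  | none => W
  | some f => prefEnd f W

/-- `g ∈ Γ⁺(I)` for a list `I` of flaws. -/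
def GammaPlusL (sim : F → F → Prop) (I : List F) (g : F) : Prop := ∃ f ∈ I, f = g ∨ sim f g

/-- The steps of one round, starting at state `σ` with already-addressed flaws `I`:
each addressed flaw `f` satisfies `f ∈ F_σ − Γ⁺(I)` and the step is valid. -/
def RoundFrom (S : Setup Ω F) (sim : F → F → Prop) : Ω → List F → List (F × Ω) → Prop
  | _, _, [] => True
  | σ, I, (f, σ') :: rest =>
      S.mem f σ ∧ ¬ GammaPlusL sim I f ∧ σ' ∈ S.Act f σ ∧
      RoundFrom S sim σ' (I ++ [f]) rest

/-- Like `RoundFrom`, but the addressed flaw is moreover the `≼`-least of `F_σ − Γ⁺(I)`. -/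
def RoundFromPi [LinearOrder F] (S : Setup Ω F) (sim : F → F → Prop) :
    Ω → List F → List (F × Ω) → Prop
  | _, _, [] => True
  | σ, I, (f, σ') :: rest =>
      S.mem f σ ∧ ¬ GammaPlusL sim I f ∧
      (∀ g, S.mem g σ → ¬ GammaPlusL sim I g → f ≤ g) ∧
      σ' ∈ S.Act f σ ∧ RoundFromPi S sim σ' (I ++ [f]) rest

/-- A walk grouped into rounds: each round is valid, and at the final state of every
round except possibly the last one, `F_σ − Γ⁺(I_r) = ∅`. -/
def RoundsFrom (S : Setup Ω F) (sim : F → F → Prop) : Ω → List (List (F × Ω)) → Prop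
  | _, [] => True
  | σ, b :: rest =>
      RoundFrom S sim σ [] b ∧
      (rest = [] ∨
        ((∀ g, S.mem g (endOf σ b) → GammaPlusL sim (b.map Prod.fst) g) ∧
          RoundsFrom S sim (endOf σ b) rest))

/-- Like `RoundsFrom`, with the `≼`-least flaw selection rule. -/
def RoundsFromPi [LinearOrder F] (S : Setup Ω F) (sim : F → F → Prop) :
    Ω → List (List (F × Ω)) → Prop
  | _, [] => True
  | σ, b :: rest =>
      RoundFromPi S sim σ [] b ∧
      (rest = [] ∨
        ((∀ g, S.mem g (endOf σ b) → GammaPlusL sim (b.map Prod.fst) g) ∧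
          RoundsFromPi S sim (endOf σ b) rest))

/-- The family `Ind^init = ∪_{σ : ωinit σ > 0} Ind(F_σ)`. -/
def indInitSets [Fintype F] (S : Setup Ω F) (sim : F → F → Prop) (ωinit : Ω → ℝ) :
    Finset (Finset F) :=
  Finset.univ.filter fun R => IndepF sim R ∧ ∃ σ, 0 < ωinit σ ∧ ∀ f ∈ R, S.mem f σ

/-- `λ_φ` for a sequence of sets of flaws. -/
def seqWt (lam : F → ℝ) (φ : List (Finset F)) : ℝ := (φ.map fun I => ∏ f ∈ I, lam f).prod

/-- `|φ| = ∑_r |I_r|`. -/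
def seqSize (φ : List (Finset F)) : ℕ := (φ.map Finset.card).sum

/-- A strongly stable sequence. -/
def StronglyStableSeq (sim : F → F → Prop) (φ : List (Finset F)) : Prop :=
  φ ≠ [] ∧ (∀ I ∈ φ, IndepF sim I) ∧
  φ.Chain' (fun I J => ∀ g ∈ J, ∃ f ∈ I, sim f g) ∧
  ∀ I ∈ φ.tail, I ≠ ∅

/-- Membership in `Stab(R,S,t,ℓ)`. -/
def StabRSTL (sim : F → F → Prop) (R S : Finset F) (t ℓ : ℕ) (φ : List (Finset F)) : Prop :=
  φ.head? = some R ∧ φ.length ≤ ℓ ∧ t ≤ seqSize φ ∧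
  ((φ.length = 1 ∧ S = ∅) ∨
    (2 ≤ φ.length ∧ S = φ.tail.headI.filter (fun g => ¬ ∃ f ∈ R, sim f g) ∧
      StronglyStableSeq sim φ.tail))

/-- One valid swap on words. -/
def WordSwap (sim : F → F → Prop) (W W' : List F) : Prop :=
  ∃ (A B : List F) (f g : F), f ≠ g ∧ ¬ sim f g ∧ W = A ++ f :: g :: B ∧ W' = A ++ g :: f :: B

end LLLFormal

namespace LLLFormal

/-- The step lists of the valid walks that start at a given state and have a given flaw word. -/
def paths {Ω F : Type*} [Fintype Ω] (S : Setup Ω F) : List F → Ω → Finset (List (F × Ω))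
  | [], _ => {[]}
  | f :: W, σ =>
      (Finset.univ.filter fun σ' => S.step f σ σ').biUnion fun σ' =>
        (paths S W σ').image (List.cons (f, σ'))

/-- The independent sets of flaws contained in `Γ(R)`. -/
def indNbr {F : Type*} [Fintype F] (sim : F → F → Prop) (R : Finset F) : Finset (Finset F) :=
  Finset.univ.filter fun J => (∀ g ∈ J, ∃ f ∈ R, sim f g) ∧ IndepF sim J

/-- The sequences of `n` sets of flaws whose first member lies in `A` and in which each set is
followed by an independent subset of its neighbourhood. -/
def stableSeqs {F : Type*} [Fintype F] [DecidableEq F] (sim : F → F → Prop) :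
    ℕ → Finset (Finset F) → Finset (List (Finset F))
  | 0, _ => {[]}
  | n + 1, A => A.biUnion fun R => (stableSeqs sim n (indNbr sim R)).image (List.cons R)

/-- The word that lists the members of the sets of a sequence, each set in increasing order. -/
def seqWord {F : Type*} [LinearOrder F] (φ : List (Finset F)) : List F :=
  (φ.map fun I => I.sort (· ≤ ·)).flatten

lemma exists_validFrom_of_map_eq_append {Ω F : Type*} {step : F → Ω → Ω → Prop} {σ : Ω}
    {l : List (F × Ω)} (hl : ValidFrom step σ l) {p q : List F} (hw : l.map Prod.fst = p ++ q) :
    ∃ σ' l', ValidFrom step σ' l' ∧ l'.map Prod.fst = q := by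
  induction p generalizing σ l with
  | nil => exact ⟨σ, l, hl, hw⟩
  | cons a p ih =>
    obtain _ | ⟨⟨f, σ'⟩, l⟩ := l
    · simp at hw
    · exact ih hl.2 (List.cons.inj hw).2

section Walks

variable {Ω F : Type*} [Fintype Ω] {S : Setup Ω F}

lemma mem_paths {l : List (F × Ω)} {σ : Ω} (hl : ValidFrom S.step σ l) :
    l ∈ paths S (l.map Prod.fst) σ := by
  induction l generalizing σ with
  | nil => simp [paths]
  | cons a l ih =>
    obtain ⟨f, σ'⟩ := a
    obtain ⟨h1, h2⟩ := hl
    simp only [List.map_cons, paths, Finset.mem_biUnion, Finset.mem_filter, Finset.mem_univ,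
      true_and, Finset.mem_image]
    exact ⟨σ', h1, l, ih h2, rfl⟩

lemma prodRho_nonneg (l : List (F × Ω)) (σ : Ω) : 0 ≤ prodRho S.ρ σ l := by
  induction l generalizing σ with
  | nil => simp [prodRho]
  | cons a l ih => exact mul_nonneg (S.ρ_nonneg _ _ _) (ih _)

lemma wordWt_nonneg {w : F → ℝ} (hw : ∀ f, 0 ≤ w f) (W : List F) : 0 ≤ wordWt w W :=
  List.prod_nonneg (by simpa using fun f _ => hw f)

lemma sum_paths_cons (f : F) (W : List F) (σ : Ω) :
    ∑ l ∈ paths S (f :: W) σ, prodRho S.ρ σ l =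
      ∑ σ', if S.step f σ σ' then S.ρ f σ σ' * ∑ l ∈ paths S W σ', prodRho S.ρ σ' l else 0 := by
  rw [paths, Finset.sum_biUnion, Finset.sum_filter]
  · refine Finset.sum_congr rfl fun σ' _ => ?_
    split_ifs
    · rw [Finset.sum_image fun _ _ _ _ h => (List.cons.inj h).2, Finset.mul_sum]
      rfl
    · rfl
  · intro a _ b _ hab
    simp only [Function.onFun, Finset.disjoint_left, Finset.mem_image]
    rintro _ ⟨x, _, rfl⟩ ⟨y, _, hy⟩
    exact hab (by simpa using (List.cons.inj hy).1.symm)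

lemma sum_paths_le {ω : Ω → ℝ} (hω : IsPosProb ω) {lam : F → ℝ} (hlam : ∀ f, 0 ≤ lam f)
    (hA : CondA S ω lam) (W : List F) :
    ∑ σ, ω σ * ∑ l ∈ paths S W σ, prodRho S.ρ σ l ≤ wordWt lam W := by
  induction W with
  | nil => simp [paths, prodRho, wordWt, hω.2]
  | cons f W ih =>
    set G : Ω → ℝ := fun σ => ∑ l ∈ paths S W σ, prodRho S.ρ σ l with hG
    have hG0 : ∀ σ, 0 ≤ G σ := fun σ => Finset.sum_nonneg fun l _ => prodRho_nonneg l σ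
    calc ∑ σ, ω σ * ∑ l ∈ paths S (f :: W) σ, prodRho S.ρ σ l
        = ∑ σ, ∑ σ', ω σ * (if S.step f σ σ' then S.ρ f σ σ' * G σ' else 0) := by
          simp only [sum_paths_cons, Finset.mul_sum, hG]
      _ = ∑ σ', ∑ σ, ω σ * (if S.step f σ σ' then S.ρ f σ σ' * G σ' else 0) :=
          Finset.sum_comm
      _ = ∑ σ', ω σ' * G σ' *
            ∑ σ, if S.mem f σ ∧ σ' ∈ S.Act f σ then S.ρ f σ σ' * ω σ / ω σ' else 0 := by
          refine Finset.sum_congr rfl fun σ' _ => ?_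
          rw [Finset.mul_sum]
          refine Finset.sum_congr rfl fun σ _ => ?_
          have := (hω.1 σ').ne'
          by_cases h : S.mem f σ ∧ σ' ∈ S.Act f σ
          · rw [if_pos h, if_pos (show S.step f σ σ' from h)]
            field_simp
          · rw [if_neg h, if_neg (show ¬ S.step f σ σ' from h)]
            simp
      _ ≤ ∑ σ', ω σ' * G σ' * lam f :=
          Finset.sum_le_sum fun σ' _ =>
            mul_le_mul_of_nonneg_left (hA f σ') (mul_nonneg (hω.1 σ').le (hG0 σ'))
      _ = lam f * ∑ σ', ω σ' * G σ' := by
          rw [← Finset.sum_mul, mul_comm]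
      _ ≤ lam f * wordWt lam W := mul_le_mul_of_nonneg_left ih (hlam f)
      _ = wordWt lam (f :: W) := by simp [wordWt]

lemma le_gammaInit_mul [Nonempty Ω] {ω : Ω → ℝ} (hω : IsPosProb ω) (ωinit : Ω → ℝ) (σ : Ω) :
    ωinit σ ≤ gammaInit ωinit ω * ω σ := by
  rw [← div_le_iff₀ (hω.1 σ)]
  exact Finset.le_sup' (fun σ => ωinit σ / ω σ) (Finset.mem_univ σ)

lemma gammaInit_nonneg [Nonempty Ω] {ω ωinit : Ω → ℝ} (hω : IsPosProb ω)
    (hinit : IsProb ωinit) : 0 ≤ gammaInit ωinit ω := by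
  obtain ⟨σ⟩ := ‹Nonempty Ω›
  exact nonneg_of_mul_nonneg_left ((hinit.1 σ).trans (le_gammaInit_mul hω ωinit σ)) (hω.1 σ)

/-- The walks with a common flaw word `W` have total weight at most `γ^init λ_W`. -/
lemma sum_wt_le [Nonempty Ω] {ω ωinit : Ω → ℝ} (hω : IsPosProb ω) (hinit : IsProb ωinit)
    {lam : F → ℝ} (hlam : ∀ f, 0 ≤ lam f) (hA : CondA S ω lam) (W : List F)
    (T : Finset (Walk Ω F)) (hT : ∀ τ ∈ T, τ.Valid S.step ∧ τ.word = W) :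
    ∑ τ ∈ T, τ.wt ωinit S.ρ ≤ gammaInit ωinit ω * wordWt lam W := by
  set toWalk : (_ : Ω) × List (F × Ω) → Walk Ω F := fun x => ⟨x.1, x.2⟩
  have hsub : T ⊆ (Finset.univ.sigma (paths S W)).image toWalk := by
    intro τ hτ
    obtain ⟨hv, rfl⟩ := hT τ hτ
    exact Finset.mem_image.2 ⟨⟨τ.start, τ.steps⟩,
      Finset.mem_sigma.2 ⟨Finset.mem_univ _, mem_paths hv⟩, rfl⟩
  have hγ := gammaInit_nonneg hω hinit
  calc ∑ τ ∈ T, τ.wt ωinit S.ρ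
      ≤ ∑ τ ∈ (Finset.univ.sigma (paths S W)).image toWalk, τ.wt ωinit S.ρ :=
        Finset.sum_le_sum_of_subset_of_nonneg hsub fun τ _ _ =>
          mul_nonneg (hinit.1 _) (prodRho_nonneg _ _)
    _ = ∑ σ, ωinit σ * ∑ l ∈ paths S W σ, prodRho S.ρ σ l := by
        rw [Finset.sum_image, Finset.sum_sigma]
        · simp only [Finset.mul_sum]
          rfl
        · rintro ⟨a, b⟩ _ ⟨c, d⟩ _ h
          simp only [toWalk, Walk.mk.injEq] at h
          obtain ⟨rfl, rfl⟩ := h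
          rfl
    _ ≤ ∑ σ, gammaInit ωinit ω * ω σ * ∑ l ∈ paths S W σ, prodRho S.ρ σ l :=
        Finset.sum_le_sum fun σ _ => mul_le_mul_of_nonneg_right (le_gammaInit_mul hω ωinit σ)
          (Finset.sum_nonneg fun l _ => prodRho_nonneg l σ)
    _ = gammaInit ωinit ω * ∑ σ, ω σ * ∑ l ∈ paths S W σ, prodRho S.ρ σ l := by
        simp only [Finset.mul_sum, mul_assoc]
    _ ≤ gammaInit ωinit ω * wordWt lam W :=
        mul_le_mul_of_nonneg_left (sum_paths_le hω hlam hA W) hγ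

/-- A flaw addressed after flaws none of which can cause it was present from the start and was
not addressed in the meantime. -/
lemma mem_and_notMem_of_not_sim {sim : F → F → Prop} (hcaus : Causality S sim) {σ : Ω}
    {l : List (F × Ω)} (hl : ValidFrom S.step σ l) {p q : List F} {g : F}
    (hw : l.map Prod.fst = p ++ g :: q) (hp : ∀ f ∈ p, ¬ sim f g) : S.mem g σ ∧ g ∉ p := by
  induction p generalizing σ l with
  | nil =>
    obtain _ | ⟨⟨f, σ'⟩, l⟩ := l
    · simp at hw
    · obtain ⟨rfl, -⟩ : f = g ∧ _ := by simpa using hw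
      exact ⟨hl.1.1, by simp⟩
  | cons a p ih =>
    obtain _ | ⟨⟨f, σ'⟩, l⟩ := l
    · simp at hw
    · obtain ⟨rfl, hw'⟩ : f = a ∧ l.map Prod.fst = p ++ g :: q := by simpa using hw
      obtain ⟨h1, h2⟩ := ih hl.2 hw' fun f hf => hp f (by simp [hf])
      rcases hcaus _ _ _ hl.1 g h1 with h | h
      · exact ⟨h.1, by simp [h.2, h2]⟩
      · exact absurd h (hp _ (by simp))

end Walks

lemma length_le_length_flatten {α : Type*} {B : List (List α)} (hB : ∀ b ∈ B, b ≠ []) :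
    B.length ≤ B.flatten.length := by
  induction B with
  | nil => simp
  | cons b B ih =>
    have h1 := List.length_pos_iff.2 (hB b (by simp))
    have h2 := ih fun c hc => hB c (by simp [hc])
    simp only [List.length_cons, List.flatten_cons, List.length_append]
    omega

section Words

variable {F : Type*} [LinearOrder F]

lemma seqWord_cons (R : Finset F) (φ : List (Finset F)) :
    seqWord (R :: φ) = R.sort (· ≤ ·) ++ seqWord φ := rfl

lemma wordWt_seqWord_cons (w : F → ℝ) (R : Finset F) (φ : List (Finset F)) :
    wordWt w (seqWord (R :: φ)) = (∏ f ∈ R, w f) * wordWt w (seqWord φ) := by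
  have : ((R.sort (· ≤ ·)).map w).prod = ∏ f ∈ R, w f := by
    rw [← List.prod_toFinset w (Finset.sort_nodup R _), Finset.sort_toFinset]
  rw [seqWord_cons, wordWt, List.map_append, List.prod_append, this]
  rfl

lemma indepF_toFinset {sim : F → F → Prop} (hsym : ∀ ⦃f g⦄, sim f g → sim g f) {b : List F}
    (hb : b.Pairwise fun f g => ¬ sim f g) :
    IndepF sim b.toFinset := by
  intro f hf g hg hfg
  have : Std.Symm fun f g => ¬ sim f g := ⟨fun _ _ h h' => h (hsym h')⟩
  exact hb.forall (List.mem_toFinset.1 hf) (List.mem_toFinset.1 hg) hfg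

end Words

section Sequences

variable {F : Type*} [Fintype F] {sim : F → F → Prop}

lemma empty_mem_indNbr (R : Finset F) : ∅ ∈ indNbr sim R :=
  Finset.mem_filter.2 ⟨Finset.mem_univ _, by simp, by simp [IndepF]⟩

/-- The independent subsets of `Γ(R)` have total weight at most the product, over `f ∈ R`, of
the total weights of the independent subsets of `Γ(f)`. -/
lemma sum_indNbr_le_prod {μ : F → ℝ} (hμ : ∀ f, 0 ≤ μ f) (R : Finset F) :
    ∑ J ∈ indNbr sim R, ∏ g ∈ J, μ g ≤ ∏ f ∈ R, ∑ J ∈ indNbr sim {f}, ∏ g ∈ J, μ g := by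
  have h0 : ∀ J : Finset F, 0 ≤ ∏ g ∈ J, μ g := fun J => Finset.prod_nonneg fun g _ => hμ g
  induction R using Finset.induction with
  | empty =>
    have : indNbr sim (∅ : Finset F) = {∅} := by
      ext J
      simp only [indNbr, Finset.mem_filter, Finset.mem_univ, true_and, Finset.mem_singleton]
      refine ⟨fun h => Finset.eq_empty_of_forall_notMem fun g hg => by simpa using h.1 g hg, ?_⟩
      rintro rfl
      simp [IndepF]
    simp [this]
  | insert f R hf ih =>
    rw [Finset.prod_insert hf]
    refine le_trans ?_ (mul_le_mul_of_nonneg_left ih (Finset.sum_nonneg fun J _ => h0 J))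
    rw [Finset.sum_mul_sum, ← Finset.sum_product']
    set e : Finset F → Finset F × Finset F :=
      fun J => (J.filter (sim f), J.filter fun g => ¬ sim f g)
    have hinj : Function.Injective e := by
      intro J K h
      obtain ⟨h1, h2⟩ := Prod.mk.inj h
      rw [← Finset.filter_union_filter_not_eq (sim f) J,
        ← Finset.filter_union_filter_not_eq (sim f) K, h1, h2]
    calc ∑ J ∈ indNbr sim (insert f R), ∏ g ∈ J, μ g
        = ∑ x ∈ (indNbr sim (insert f R)).image e, (∏ g ∈ x.1, μ g) * ∏ g ∈ x.2, μ g := by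
          rw [Finset.sum_image hinj.injOn]
          exact Finset.sum_congr rfl fun J _ =>
            (Finset.prod_filter_mul_prod_filter_not J (sim f) μ).symm
      _ ≤ _ := by
          refine Finset.sum_le_sum_of_subset_of_nonneg ?_ fun x _ _ => mul_nonneg (h0 _) (h0 _)
          intro x hx
          obtain ⟨J, hJ, rfl⟩ := Finset.mem_image.1 hx
          simp only [indNbr, Finset.mem_filter, Finset.mem_univ, true_and] at hJ
          simp only [e, indNbr, Finset.mem_product, Finset.mem_filter, Finset.mem_univ, true_and]
          have hind : ∀ K ⊆ J, IndepF sim K := fun K hK a ha b hb => hJ.2 a (hK ha) b (hK hb)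
          refine ⟨⟨by simp, hind _ (Finset.filter_subset _ _)⟩, ?_,
            hind _ (Finset.filter_subset _ _)⟩
          rintro g ⟨hg, hfg⟩
          obtain ⟨k, hk, hkg⟩ := hJ.1 g hg
          rcases Finset.mem_insert.1 hk with rfl | hk
          · exact absurd hkg hfg
          · exact ⟨k, hk, hkg⟩

lemma prod_mul_sum_indNbr_le {lam μ : F → ℝ} {θ : ℝ} (hlam : ∀ f, 0 < lam f)
    (hμ : ∀ f, 0 < μ f) (hθ : 0 < θ) (hCE : ClusterCond sim lam μ θ) (R : Finset F) :
    (∏ f ∈ R, lam f / θ) * ∑ J ∈ indNbr sim R, ∏ g ∈ J, μ g ≤ ∏ f ∈ R, μ f := by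
  have h0 : ∀ f, 0 ≤ lam f / θ := fun f => (div_pos (hlam f) hθ).le
  have hs : ∀ f, 0 ≤ ∑ J ∈ indNbr sim {f}, ∏ g ∈ J, μ g := fun f =>
    Finset.sum_nonneg fun J _ => Finset.prod_nonneg fun g _ => (hμ g).le
  refine (mul_le_mul_of_nonneg_left (sum_indNbr_le_prod (fun f => (hμ f).le) R)
    (Finset.prod_nonneg fun f _ => h0 f)).trans ?_
  rw [← Finset.prod_mul_distrib]
  refine Finset.prod_le_prod (fun f _ => mul_nonneg (h0 f) (hs f)) fun f _ => ?_
  have h := hCE f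
  have he : indNbr sim {f} =
      Finset.univ.filter (fun I : Finset F => (∀ g ∈ I, sim f g) ∧ IndepF sim I) := by
    ext; simp [indNbr]
  rw [← he, div_mul_eq_mul_div, div_le_iff₀ (hμ f)] at h
  rw [div_mul_eq_mul_div, div_le_iff₀ hθ]
  linarith

lemma empty_mem_indInitSets {Ω : Type*} [Fintype Ω] {S : Setup Ω F} {ωinit : Ω → ℝ} {σ : Ω}
    (hσ : 0 < ωinit σ) : ∅ ∈ indInitSets S sim ωinit := by
  simp only [indInitSets, Finset.mem_filter, Finset.mem_univ, true_and]
  exact ⟨by simp [IndepF], σ, hσ, by simp⟩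

variable [LinearOrder F]

lemma sum_stableSeqs_le {lam μ : F → ℝ} {θ : ℝ} (hlam : ∀ f, 0 < lam f)
    (hμ : ∀ f, 0 < μ f) (hθ : 0 < θ) (hCE : ClusterCond sim lam μ θ) (n : ℕ)
    (A : Finset (Finset F)) (hA : ∅ ∈ A) :
    ∑ φ ∈ stableSeqs sim n A, wordWt (fun f => lam f / θ) (seqWord φ) ≤
      ∑ R ∈ A, ∏ f ∈ R, μ f := by
  induction n generalizing A with
  | zero =>
    have := Finset.single_le_sum (f := fun R : Finset F => ∏ f ∈ R, μ f)
      (fun R _ => Finset.prod_nonneg fun f _ => (hμ f).le) hA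
    simpa [stableSeqs, seqWord, wordWt] using this
  | succ n ih =>
    rw [stableSeqs, Finset.sum_biUnion]
    · refine Finset.sum_le_sum fun R _ => ?_
      rw [Finset.sum_image fun _ _ _ _ h => (List.cons.inj h).2]
      simp only [wordWt_seqWord_cons, ← Finset.mul_sum]
      exact (mul_le_mul_of_nonneg_left (ih _ (empty_mem_indNbr R))
        (Finset.prod_nonneg fun f _ => (div_pos (hlam f) hθ).le)).trans
        (prod_mul_sum_indNbr_le hlam hμ hθ hCE R)
    · intro a _ b _ hab
      simp only [Function.onFun, Finset.disjoint_left, Finset.mem_image]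
      rintro _ ⟨x, _, rfl⟩ ⟨y, _, hy⟩
      exact hab (List.cons.inj hy).1.symm

/-- A walk with a `π`-stable word is encoded by a sequence of `stableSeqs`, obtained by padding
the sequence of its blocks with empty sets. -/
lemma exists_mem_stableSeqs {Ω : Type*} [Fintype Ω] {S : Setup Ω F}
    (hsym : ∀ ⦃f g⦄, sim f g → sim g f) (hcaus : Causality S sim) (n : ℕ)
    (A : Finset (Finset F)) (hA : ∅ ∈ A) (B : List (List F))
    (σ : Ω) (l : List (F × Ω)) (hl : ValidFrom S.step σ l)
    (hB : PiStablePartition sim B (l.map Prod.fst)) (hn : B.length ≤ n)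
    (hhead : ∀ b ∈ B.head?, b.toFinset ∈ A) :
    ∃ φ ∈ stableSeqs sim n A, seqWord φ = l.map Prod.fst := by
  induction n generalizing A B σ l with
  | zero =>
    obtain rfl : B = [] := List.length_eq_zero_iff.1 (by omega)
    exact ⟨[], by simp [stableSeqs], by simp [hB.1.1, seqWord]⟩
  | succ n ih =>
    simp only [stableSeqs, Finset.mem_biUnion, Finset.mem_image]
    obtain _ | ⟨b, B⟩ := B
    · obtain ⟨φ, hφ, hw⟩ := ih (indNbr sim ∅) (empty_mem_indNbr _) [] σ l hl hB (by simp) (by simp)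
      exact ⟨∅ :: φ, ⟨∅, hA, φ, hφ, rfl⟩, by simpa [seqWord_cons] using hw⟩
    · obtain ⟨⟨hw, hblocks, hchain⟩, hsort⟩ := hB
      rw [List.flatten_cons] at hw
      obtain ⟨σ', l', hl', hw'⟩ := exists_validFrom_of_map_eq_append hl hw
      obtain ⟨φ, hφ, hφw⟩ := ih (indNbr sim b.toFinset) (empty_mem_indNbr _) B σ' l' hl'
        ⟨⟨hw', fun c hc => hblocks c (by simp [hc]), hchain.tail⟩,
          fun c hc => hsort c (by simp [hc])⟩ (by simpa using hn) (by
          intro c hc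
          obtain _ | ⟨c', B⟩ := B
          · simp at hc
          obtain rfl : c' = c := by simpa using hc
          have hcb := hblocks c' (by simp)
          simp only [indNbr, Finset.mem_filter, Finset.mem_univ, true_and, List.mem_toFinset]
          refine ⟨fun g hg => ?_, indepF_toFinset hsym hcb.2.2⟩
          by_contra! hno
          obtain ⟨f, hfb, rfl | hfg⟩ := (List.isChain_cons_cons.1 hchain).1 g hg
          · obtain ⟨p, q, rfl⟩ := List.append_of_mem hg
            have := mem_and_notMem_of_not_sim hcaus hl (p := b ++ p) (q := q ++ B.flatten) (g := f)
              (by simpa using hw) (by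
                intro x hx
                rcases List.mem_append.1 hx with hx | hx
                · exact hno x hx
                · exact (List.pairwise_append.1 hcb.2.2).2.2 x hx f (by simp))
            exact this.2 (by simp [hfb])
          · exact hno f hfb hfg)
      refine ⟨b.toFinset :: φ, ⟨b.toFinset, hhead b (by simp), φ, hφ, rfl⟩, ?_⟩
      have hbs : b.Pairwise (· < ·) := List.isChain_iff_pairwise.1 (hsort b (by simp))
      rw [seqWord_cons, hφw, hw, hw', (List.toFinset_sort (· ≤ ·) (hblocks b (by simp)).2.1).2
        (hbs.imp le_of_lt)]

/-- A bad walk with a `π`-stable word is encoded by a sequence whose first set is in `Ind^init`. -/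
lemma exists_mem_stableSeqs_indInitSets {Ω : Type*} [Fintype Ω] {S : Setup Ω F}
    (hsym : ∀ ⦃f g⦄, sim f g → sim g f) (hcaus : Causality S sim) {ωinit : Ω → ℝ}
    {Λ : Walk Ω F → F} {t : ℕ} {τ : Walk Ω F} (hτ : τ ∈ Bad S Λ ωinit t)
    (hst : PiStableWord sim τ.word) :
    ∃ φ ∈ stableSeqs sim t (indInitSets S sim ωinit), seqWord φ = τ.word := by
  obtain ⟨hv, hlen, -, hpos⟩ := hτ
  obtain ⟨B, hB⟩ := hst
  have hw : τ.steps.map Prod.fst = B.flatten := hB.1.1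
  refine exists_mem_stableSeqs hsym hcaus t _ (empty_mem_indInitSets hpos) B τ.start
    τ.steps hv hB ?_ ?_
  · have := length_le_length_flatten fun b hb => (hB.1.2.1 b hb).1
    rw [← hw, List.length_map] at this
    exact this.trans hlen.le
  · intro b hb
    obtain _ | ⟨c, B⟩ := B
    · simp at hb
    obtain rfl : c = b := by simpa using hb
    have hind := (hB.1.2.1 c (by simp)).2.2
    simp only [indInitSets, Finset.mem_filter, Finset.mem_univ, true_and, List.mem_toFinset]
    refine ⟨indepF_toFinset hsym hind, τ.start, hpos, fun g hg => ?_⟩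
    obtain ⟨p, q, rfl⟩ := List.append_of_mem hg
    exact (mem_and_notMem_of_not_sim hcaus hv (p := p) (q := q ++ B.flatten) (by simpa using hw)
      fun f hf => (List.pairwise_append.1 hind).2.2 f hf g (by simp)).1

end Sequences

/-- Theorem 1(a), cluster-expansion case: for a strategy all of whose bad
`t`-trajectories are π-stable (e.g. the π-stable strategy),
`∑_{τ∈Bad(t)} p(τ) ≤ γ^init (∑_{R∈Ind^init} μ(R)) θ^t`. -/
theorem stmt_5 {Ω F : Type*} [Fintype Ω] [Nonempty Ω] [Fintype F] [LinearOrder F]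
    (S : Setup Ω F) (sim : F → F → Prop) (hsym : Symmetric sim) (hcaus : Causality S sim)
    (ω ωinit : Ω → ℝ) (hω : IsPosProb ω) (hinit : IsProb ωinit)
    (lam μ : F → ℝ) (θ : ℝ)
    (hlam : ∀ f, 0 < lam f) (hμ : ∀ f, 0 < μ f) (hθ0 : 0 < θ) (hθ1 : θ < 1)
    (hA : CondA S ω lam) (hCE : ClusterCond sim lam μ θ)
    (Λ : Walk Ω F → F) (hΛ : IsStrategy S Λ) (t : ℕ)
    (hstable : ∀ τ ∈ Bad S Λ ωinit t, PiStableWord sim (Walk.word τ))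
    (hfin : (Bad S Λ ωinit t).Finite) :
    (∑ τ ∈ hfin.toFinset, Walk.wt ωinit S.ρ τ) ≤
      gammaInit ωinit ω * (∑ R ∈ indInitSets S sim ωinit, ∏ f ∈ R, μ f) * θ ^ t := by
  set A := indInitSets S sim ωinit
  have hγ := gammaInit_nonneg hω hinit
  have hw : ∀ f, 0 ≤ lam f / θ := fun f => (div_pos (hlam f) hθ0).le
  have hwt : ∀ W : List F, wordWt lam W = θ ^ W.length * wordWt (fun f => lam f / θ) W := by
    intro W
    induction W with
    | nil => simp [wordWt]
    | cons f W ih =>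
      simp only [wordWt, List.map_cons, List.prod_cons, List.length_cons] at ih ⊢
      rw [ih, pow_succ]
      field_simp
  have hbad : ∀ τ ∈ hfin.toFinset, τ ∈ Bad S Λ ωinit t := fun τ hτ => hfin.mem_toFinset.1 hτ
  have henc : ∀ τ : Walk Ω F, ∃ φ, τ ∈ Bad S Λ ωinit t →
      φ ∈ stableSeqs sim t A ∧ seqWord φ = τ.word := by
    intro τ
    by_cases hτ : τ ∈ Bad S Λ ωinit t
    · obtain ⟨φ, h⟩ := exists_mem_stableSeqs_indInitSets hsym hcaus hτ (hstable τ hτ)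
      exact ⟨φ, fun _ => h⟩
    · exact ⟨[], fun h => absurd h hτ⟩
  choose enc henc using henc
  have hempty : ∅ ∈ A := by
    obtain ⟨σ, hσ⟩ : ∃ σ, 0 < ωinit σ := by
      by_contra! h
      have := Finset.sum_nonpos fun σ (_ : σ ∈ Finset.univ) => h σ
      linarith [hinit.2]
    exact empty_mem_indInitSets hσ
  calc ∑ τ ∈ hfin.toFinset, τ.wt ωinit S.ρ
      = ∑ φ ∈ stableSeqs sim t A, ∑ τ ∈ hfin.toFinset with enc τ = φ, τ.wt ωinit S.ρ :=
        (Finset.sum_fiberwise_of_maps_to (fun τ hτ => (henc τ (hbad τ hτ)).1) _).symm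
    _ ≤ ∑ φ ∈ stableSeqs sim t A,
          gammaInit ωinit ω * (θ ^ t * wordWt (fun f => lam f / θ) (seqWord φ)) := by
        refine Finset.sum_le_sum fun φ _ => ?_
        by_cases hlen : (seqWord φ).length = t
        · have h := hwt (seqWord φ)
          rw [hlen] at h
          rw [← h]
          refine sum_wt_le hω hinit (fun f => (hlam f).le) hA _ _ fun τ hτ => ?_
          obtain ⟨hmem, rfl⟩ := Finset.mem_filter.1 hτ
          exact ⟨(hbad τ hmem).1, (henc τ (hbad τ hmem)).2.symm⟩
        · rw [Finset.filter_false_of_mem, Finset.sum_empty]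
          · exact mul_nonneg hγ (mul_nonneg (pow_nonneg hθ0.le _) (wordWt_nonneg hw _))
          · rintro τ hτ rfl
            refine hlen ?_
            rw [(henc τ (hbad τ hτ)).2, Walk.word, List.length_map]
            exact (hbad τ hτ).2.1
    _ = gammaInit ωinit ω *
          (∑ φ ∈ stableSeqs sim t A, wordWt (fun f => lam f / θ) (seqWord φ)) * θ ^ t := by
        rw [← Finset.mul_sum, ← Finset.mul_sum]
        ring
    _ ≤ gammaInit ωinit ω * (∑ R ∈ A, ∏ f ∈ R, μ f) * θ ^ t := by
        gcongr
        exact sum_stableSeqs_le hlam hμ hθ0 hCE t A hempty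

end LLLFormal
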